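/- Let C⃗ be any orientation of the 4-cycle C₄. If G is a graph with m(G) < 3/2, then some orientation of G contains no copy of C⃗. -/

import Mathlib

/-- An orientation of a simple graph `G`: an assignment of a direction to each edge. -/
structure GraphOrientation {V : Type*} (G : SimpleGraph V) where
  adj : V → V → Prop
  le : ∀ {u v}, adj u v → G.Adj u v
  total : ∀ {u v}, G.Adj u v → adj u v ∨ adj v u
  asymm : ∀ {u v}, adj u v → ¬ adj v u

open Finset in
/-- A nonempty vertex set of a graph with `m(G) < 3/2` contains a vertex with at most two
neighbours in that set. -/
theorem exists_ncard_neighbors_le_two {V : Type*} [Fintype V] (G : SimpleGraph V)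
    (hm : ∀ J : G.Subgraph, J.verts.Nonempty →
      (J.edgeSet.ncard : ℚ) < (3 / 2 : ℚ) * J.verts.ncard)
    (S : Finset V) (hS : S.Nonempty) :
    ∃ v ∈ S, {b | b ∈ S ∧ G.Adj v b}.ncard ≤ 2 := by
  classical
  by_contra! hdeg
  have hJ := hm ((⊤ : G.Subgraph).induce S) (by simpa using hS)
  set J := (⊤ : G.Subgraph).induce S with hJdef
  have hsum := J.spanningCoe.sum_degrees_eq_twice_card_edges
  have hedges : J.edgeSet.ncard = #J.spanningCoe.edgeFinset := by
    rw [← J.edgeSet_spanningCoe, ← SimpleGraph.coe_edgeFinset, Set.ncard_coe_finset]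
  have hlow : #S * 3 ≤ ∑ v, J.spanningCoe.degree v := by
    rw [← smul_eq_mul]
    refine (Finset.card_nsmul_le_sum S (fun v => J.spanningCoe.degree v) 3 fun v hv => ?_).trans
      (Finset.sum_le_sum_of_subset (Finset.subset_univ S))
    have hv3 := hdeg v hv
    have hset : {b | b ∈ S ∧ G.Adj v b} = (J.spanningCoe.neighborFinset v : Set V) := by
      ext b
      simp [hJdef, hv]
    rw [hset, Set.ncard_coe_finset] at hv3
    exact hv3
  have hverts : J.verts.ncard = #S := by simp [hJdef]
  rw [hedges, hverts] at hJ
  have : (#S * 3 : ℚ) ≤ 2 * #J.spanningCoe.edgeFinset := by exact_mod_cast hsum ▸ hlow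
  linarith

/-- The pair `a, b` is joined by an arc whose direction is prescribed by `s`. -/
def Arc {V : Type*} (E : V → V → Prop) (s : Bool) (a b : V) : Prop :=
  (s = true → E a b) ∧ (s = false → E b a)

/-- `f` is a copy in `E` of the oriented 4-cycle encoded by `σ`. -/
def IsCopy {V : Type*} (E : V → V → Prop) (σ : Fin 4 → Bool) (f : Fin 4 → V) : Prop :=
  Function.Injective f ∧ ∀ i, Arc E (σ i) (f i) (f (i + 1))

/-- `τ` and `σ` encode the same oriented 4-cycle, up to a rotation or a reflection. -/
def SameCycle (τ σ : Fin 4 → Bool) : Prop :=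
  ∃ k : Fin 4, (∀ i, τ i = σ (i + k)) ∨ ∀ i, τ i = !σ (k - i)

instance (τ σ : Fin 4 → Bool) : Decidable (SameCycle τ σ) := by
  unfold SameCycle
  infer_instance

section

variable {V : Type*} {E : V → V → Prop}

@[simp]
theorem arc_not {s : Bool} {a b : V} : Arc E (!s) a b ↔ Arc E s b a := by
  cases s <;> simp [Arc]

theorem IsCopy.rotate {σ : Fin 4 → Bool} {f : Fin 4 → V} (h : IsCopy E σ f) (k : Fin 4) :
    IsCopy E (fun i => σ (i + k)) (fun i => f (i + k)) := by
  refine ⟨h.1.comp (add_left_injective k), fun i => ?_⟩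
  have := h.2 (i + k)
  rwa [add_right_comm] at this

theorem IsCopy.reflect {σ : Fin 4 → Bool} {f : Fin 4 → V} (h : IsCopy E σ f) (k : Fin 4) :
    IsCopy E (fun i => !σ (k - i)) (fun i => f (k - i + 1)) := by
  refine ⟨h.1.comp ((add_left_injective 1).comp sub_right_injective), fun i => ?_⟩
  have := h.2 (k - i)
  rw [arc_not]
  simpa only [show k - (i + 1) + 1 = k - i by abel] using this

theorem SameCycle.exists_isCopy {τ σ : Fin 4 → Bool} (h : SameCycle τ σ) {g : Fin 4 → V}
    (hg : IsCopy E τ g) : ∃ f, IsCopy E σ f := by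
  obtain ⟨k, h | h⟩ := h
  · refine ⟨fun i => g (i + -k), ?_⟩
    convert hg.rotate (-k) using 1
    funext i
    simp [h]
  · refine ⟨fun i => g (k - i + 1), ?_⟩
    convert hg.reflect k using 1
    funext i
    simp [h]

/-- A copy through `v` can be read starting at `v`, in either direction. -/
theorem IsCopy.exists_sameCycle {σ : Fin 4 → Bool} {f : Fin 4 → V} (h : IsCopy E σ f)
    {u w : V} {i : Fin 4} (hu : f (i + 1) = u ∨ f (i + 1) = w)
    (hw : f (i + 3) = u ∨ f (i + 3) = w) :
    ∃ τ g, SameCycle τ σ ∧ IsCopy E τ g ∧ g 0 = f i ∧ g 1 = u ∧ g 3 = w := by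
  have hne : f (i + 1) ≠ f (i + 3) := fun H => by simpa using h.1 H
  have hrot : f (i + 1) = u → f (i + 3) = w →
      ∃ τ g, SameCycle τ σ ∧ IsCopy E τ g ∧ g 0 = f i ∧ g 1 = u ∧ g 3 = w := fun h1 h3 =>
    ⟨_, _, ⟨i, Or.inl fun _ => rfl⟩, h.rotate i, by simp, by rw [← h1, add_comm],
      by rw [← h3, add_comm]⟩
  have hrefl : f (i + 3) = u → f (i + 1) = w →
      ∃ τ g, SameCycle τ σ ∧ IsCopy E τ g ∧ g 0 = f i ∧ g 1 = u ∧ g 3 = w := fun h3 h1 =>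
    ⟨_, _, ⟨i + 3, Or.inr fun _ => rfl⟩, h.reflect (i + 3), by
      congr 1; clear * -; revert i; decide, by rw [← h3]; congr 1; clear * -; revert i; decide,
      by rw [← h1]; congr 1; clear * -; revert i; decide⟩
  grind

end

/-- If the pairs `t ∈ T` encode oriented paths of length two between two vertices, no two of which
form a cycle `σ`, then some pair `(α, β)` encodes a further such path with the same property. -/
theorem exists_path_avoiding (σ : Fin 4 → Bool) (T : Finset (Bool × Bool))
    (hT : ∀ t ∈ T, ∀ t' ∈ T, t ≠ t' → ¬ SameCycle ![t.1, t.2, !t'.2, !t'.1] σ) :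
    ∃ α β : Bool, ∀ t ∈ T, ¬ SameCycle ![α, t.1, t.2, !β] σ := by
  revert σ T
  set_option synthInstance.maxSize 1000 in
  decide +kernel

/-- An orientation without a copy of `σ` extends to a new vertex with at most two neighbours. -/
theorem GraphOrientation.exists_extend {V : Type*} {H H' : SimpleGraph V} {v u w : V}
    (hH : ∀ a b, H.Adj a b ↔ H'.Adj a b ∧ a ≠ v ∧ b ≠ v)
    (hv : ∀ b, H'.Adj v b → b = u ∨ b = w) (σ : Fin 4 → Bool)
    (o : GraphOrientation H) (ho : ¬ ∃ f, IsCopy o.adj σ f) :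
    ∃ o' : GraphOrientation H', ¬ ∃ f, IsCopy o'.adj σ f := by
  classical
  let T : Finset (Bool × Bool) :=
    Finset.univ.filter fun t => ∃ x, Arc o.adj t.1 u x ∧ Arc o.adj t.2 x w
  have hirr : ∀ {s a b}, Arc o.adj s a b → H.Adj a b := by
    rintro (_ | _) a b h
    · exact (o.le (h.2 rfl)).symm
    · exact o.le (h.1 rfl)
  have huniq : ∀ {s s' a b}, Arc o.adj s a b → Arc o.adj s' a b → s = s' := by
    rintro (_ | _) (_ | _) a b h h'
    · rfl
    · exact (o.asymm (h.2 rfl) (h'.1 rfl)).elim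
    · exact (o.asymm (h.1 rfl) (h'.2 rfl)).elim
    · rfl
  have key : ∃ α β : Bool, u ≠ w → ∀ t ∈ T, ¬ SameCycle ![α, t.1, t.2, !β] σ := by
    by_cases huw : u = w
    · exact ⟨true, true, fun h => (h huw).elim⟩
    obtain ⟨α, β, h⟩ := exists_path_avoiding σ T (by
      intro t ht t' ht' hne hs
      obtain ⟨x, hx1, hx2⟩ := (Finset.mem_filter.1 ht).2
      obtain ⟨y, hy1, hy2⟩ := (Finset.mem_filter.1 ht').2
      refine ho (hs.exists_isCopy (g := ![u, x, w, y]) ⟨?_, ?_⟩)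
      · have hxy : x ≠ y := by
          rintro rfl
          exact hne (Prod.ext (huniq hx1 hy1) (huniq hx2 hy2))
        have h1 := (hirr hx1).ne
        have h2 := (hirr hx2).ne
        have h3 := (hirr hy1).ne
        have h4 := (hirr hy2).ne
        intro i j hij
        fin_cases i <;> fin_cases j <;> simp_all
      · intro i
        fin_cases i
        · exact hx1
        · exact hx2
        · exact arc_not.2 hy2
        · exact arc_not.2 hy1)
    exact ⟨α, β, fun _ => h⟩
  obtain ⟨α, β, key⟩ := key
  let out : V → Bool := fun b => if b = u then α else β
  let E : V → V → Prop := fun a b =>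
    o.adj a b ∨ (a = v ∧ H'.Adj v b ∧ out b = true) ∨ (b = v ∧ H'.Adj v a ∧ out a = false)
  have hov : ∀ {a b}, o.adj a b → H'.Adj a b ∧ a ≠ v ∧ b ≠ v := fun h => (hH _ _).1 (o.le h)
  have hEle : ∀ {a b}, E a b → H'.Adj a b := by
    rintro a b (h | ⟨rfl, h, -⟩ | ⟨rfl, h, -⟩)
    exacts [(hov h).1, h, h.symm]
  have hEarc : ∀ {s a b}, Arc E s a b → H'.Adj a b := by
    rintro (_ | _) a b h
    · exact (hEle (h.2 rfl)).symm
    · exact hEle (h.1 rfl)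
  have hold : ∀ {s a b}, Arc E s a b → a ≠ v → b ≠ v → Arc o.adj s a b := by
    intro s a b h ha hb
    simpa [Arc, E, ha, hb] using h
  have hnew : ∀ {s b}, Arc E s v b → out b = s := by
    intro s b h
    have hb := (hEarc h).ne'
    have h1 : ∀ b, ¬ o.adj v b := fun b h => (hov h).2.1 rfl
    have h2 : ∀ b, ¬ o.adj b v := fun b h => (hov h).2.2 rfl
    cases s
    · rcases h.2 rfl with h | ⟨h, -⟩ | ⟨-, -, h⟩
      exacts [(h2 b h).elim, (hb h).elim, h]
    · rcases h.1 rfl with h | ⟨-, -, h⟩ | ⟨h, -⟩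
      exacts [(h1 b h).elim, h, (hb h).elim]
  refine ⟨⟨E, hEle, ?_, ?_⟩, ?_⟩
  · intro a b hab
    by_cases ha : a = v
    · subst ha
      cases hb : out b
      · exact Or.inr (Or.inr (Or.inr ⟨rfl, hab, hb⟩))
      · exact Or.inl (Or.inr (Or.inl ⟨rfl, hab, hb⟩))
    by_cases hb : b = v
    · subst hb
      cases ha : out a
      · exact Or.inl (Or.inr (Or.inr ⟨rfl, hab.symm, ha⟩))
      · exact Or.inr (Or.inr (Or.inl ⟨rfl, hab.symm, ha⟩))
    · exact (o.total ((hH a b).2 ⟨hab, ha, hb⟩)).imp Or.inl Or.inl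
  · intro a b hab hba
    by_cases ha : a = v
    · subst ha
      have h1 := hnew (s := true) ⟨fun _ => hab, by simp⟩
      have h2 := hnew (s := false) ⟨by simp, fun _ => hba⟩
      exact absurd (h1.symm.trans h2) (by simp)
    by_cases hb : b = v
    · subst hb
      have h1 := hnew (s := true) ⟨fun _ => hba, by simp⟩
      have h2 := hnew (s := false) ⟨by simp, fun _ => hab⟩
      exact absurd (h1.symm.trans h2) (by simp)
    · have h1 := hold (s := true) ⟨fun _ => hab, by simp⟩ ha hb
      have h2 := hold (s := true) ⟨fun _ => hba, by simp⟩ hb ha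
      exact o.asymm (h1.1 rfl) (h2.1 rfl)
  · rintro ⟨f, hf⟩
    change IsCopy E σ f at hf
    by_cases hfv : ∃ i, f i = v
    · obtain ⟨i, hi⟩ := hfv
      have e0 : Arc E (σ i) v (f (i + 1)) := hi ▸ hf.2 i
      have e3 : Arc E (σ (i + 3)) (f (i + 3)) v := by
        have := hf.2 (i + 3)
        rwa [show i + 3 + 1 = i by clear * -; revert i; decide, hi] at this
      obtain ⟨τ, g, hτ, hg, g0, g1, g3⟩ :=
        hf.exists_sameCycle (hv _ (hEarc e0)) (hv _ (hEarc e3).symm)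
      rw [hi] at g0
      have huw : u ≠ w := by
        rw [← g1, ← g3]
        exact fun h => absurd (hg.1 h) (by decide)
      have huv : u ≠ v := by
        rw [← g1, ← g0]
        exact fun h => absurd (hg.1 h) (by decide)
      have hwv : w ≠ v := by
        rw [← g3, ← g0]
        exact fun h => absurd (hg.1 h) (by decide)
      have hxv : g 2 ≠ v := by
        rw [← g0]
        exact fun h => absurd (hg.1 h) (by decide)
      have a0 : Arc E (τ 0) v u := g0 ▸ g1 ▸ hg.2 0
      have a1 : Arc E (τ 1) u (g 2) := g1 ▸ hg.2 1
      have a2 : Arc E (τ 2) (g 2) w := g3 ▸ hg.2 2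
      have a3 : Arc E (τ 3) w v := g0 ▸ g3 ▸ hg.2 3
      have hα : α = τ 0 := by simpa [out] using hnew a0
      have hβ : β = !τ 3 := by simpa [out, huw.symm] using hnew (arc_not.2 a3)
      refine key huw (τ 1, τ 2)
        (Finset.mem_filter.2 ⟨Finset.mem_univ _, g 2, hold a1 huv hxv, hold a2 hxv hwv⟩) ?_
      convert hτ using 1
      funext j
      fin_cases j <;> simp [hα, hβ]
    · push Not at hfv
      exact ho ⟨f, hf.1, fun i => hold (hf.2 i) (hfv _) (hfv _)⟩

/-- Let `C⃗` be any orientation of the 4-cycle `C₄` (encoded by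
`σ : Fin 4 → Bool`, where `σ i = true` means the edge `{i, i+1}` is directed
`i → i+1`).  If `G` is a graph with `m(G) < 3/2 = m₂(C₄)`, then some orientation
of `G` contains no copy of `C⃗`. -/
theorem not_oriented_ramsey_C4 {V : Type*} [Fintype V]
    (σ : Fin 4 → Bool)
    (G : SimpleGraph V)
    (hm : ∀ J : G.Subgraph, J.verts.Nonempty →
      (J.edgeSet.ncard : ℚ) < (3 / 2 : ℚ) * J.verts.ncard) :
    ∃ o : GraphOrientation G, ¬ ∃ f : Fin 4 → V, Function.Injective f ∧
      ∀ i : Fin 4, (σ i = true → o.adj (f i) (f (i + 1))) ∧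
        (σ i = false → o.adj (f (i + 1)) (f i)) := by
  classical
  have main : ∀ S : Finset V, ∃ o : GraphOrientation
      ((⊤ : G.Subgraph).induce (S : Set V)).spanningCoe, ¬ ∃ f, IsCopy o.adj σ f := by
    intro S
    induction S using Finset.strongInduction with
    | H S ih =>
      rcases S.eq_empty_or_nonempty with rfl | hS
      · refine ⟨⟨fun _ _ => False, False.elim, by simp, by simp⟩, ?_⟩
        rintro ⟨f, -, hf⟩
        cases h : σ 0
        · exact (hf 0).2 h
        · exact (hf 0).1 h
      · obtain ⟨v, hvS, hv⟩ := exists_ncard_neighbors_le_two G hm S hS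
        obtain ⟨o, ho⟩ := ih (S.erase v) (Finset.erase_ssubset hvS)
        obtain ⟨u, w, huw⟩ : ∃ u w, ∀ b, b ∈ S ∧ G.Adj v b → b = u ∨ b = w := by
          have hcases : {b | b ∈ S ∧ G.Adj v b}.ncard = 0 ∨ {b | b ∈ S ∧ G.Adj v b}.ncard = 1 ∨
            {b | b ∈ S ∧ G.Adj v b}.ncard = 2 := by omega
          rcases hcases with h | h | h
          · rw [Set.ncard_eq_zero] at h
            exact ⟨v, v, fun b hb => ((Set.ext_iff.1 h b).1 hb).elim⟩
          · obtain ⟨u, hu⟩ := Set.ncard_eq_one.1 h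
            exact ⟨u, u, fun b hb => Or.inl ((Set.ext_iff.1 hu b).1 hb)⟩
          · obtain ⟨u, w, -, hu⟩ := Set.ncard_eq_two.1 h
            exact ⟨u, w, fun b hb => (Set.ext_iff.1 hu b).1 hb⟩
        refine o.exists_extend (v := v) (u := u) (w := w) ?_ ?_ σ ho
        · intro a b
          simp
          tauto
        · intro b hb
          have hb' : v ∈ S ∧ b ∈ S ∧ G.Adj v b := by simpa using hb
          exact huw b hb'.2
  have huniv := main Finset.univ
  have hG : ((⊤ : G.Subgraph).induce ((Finset.univ : Finset V) : Set V)).spanningCoe = G := by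
    ext a b
    simp
  rw [hG] at huniv
  exact huniv
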